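/- Let (y_n) and (z_n) be sequences in S¹ with y_n ≠ z_n for every n, and suppose both sequences converge to the same point a ∈ S¹. Then the sequence of 2-dimensional subspaces y_n¹ + z_n¹ converges to ξ²(a), in the sense that the corresponding points of ℙ((ℝ³)*) given by the annihilators of these subspaces converge to the point given by the annihilator of ξ²(a). -/

import Mathlib

noncomputable section

open Filter Topology Module
open scoped LinearAlgebra.Projectivization

namespace CFF

instance {K V : Type*} [DivisionRing K] [AddCommGroup V] [Module K V] [TopologicalSpace V] :
    TopologicalSpace (ℙ K V) :=
  inferInstanceAs (TopologicalSpace (Quotient (projectivizationSetoid K V)))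

instance : TopologicalSpace (Module.Dual ℝ (Fin 3 → ℝ)) :=
  TopologicalSpace.induced (LinearEquiv.piRing ℝ ℝ (Fin 3) ℝ) inferInstance

/-- The projective line in `ℙ(ℝ³)` determined by a plane `W ≤ ℝ³`. -/
def projLine (W : Submodule ℝ (Fin 3 → ℝ)) : Set (ℙ ℝ (Fin 3 → ℝ)) :=
  {p | p.submodule ≤ W}

/-- `C ⊆ ℙ(ℝ³)` is properly convex: there is a linear functional `f` nonzero on every nonzero
vector spanning a point of the closure of `C`, such that the image of `C` in the affine chart
`{[v] : f v = 1}` is convex. -/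
def ProperlyConvex (C : Set (ℙ ℝ (Fin 3 → ℝ))) : Prop :=
  ∃ f : (Fin 3 → ℝ) →ₗ[ℝ] ℝ,
    (∀ (v : Fin 3 → ℝ) (hv : v ≠ 0), Projectivization.mk ℝ v hv ∈ closure C → f v ≠ 0) ∧
    Convex ℝ {w : Fin 3 → ℝ | f w = 1 ∧ ∃ hw : w ≠ 0, Projectivization.mk ℝ w hw ∈ C}

/-- The frontier of `C` contains no three distinct collinear points. -/
def StrictlyConvexBoundary (C : Set (ℙ ℝ (Fin 3 → ℝ))) : Prop :=
  ∀ p q r : ℙ ℝ (Fin 3 → ℝ), p ∈ frontier C → q ∈ frontier C → r ∈ frontier C →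
    p ≠ q → p ≠ r → q ≠ r →
    ∀ W : Submodule ℝ (Fin 3 → ℝ), finrank ℝ W = 2 →
      ¬ (p.submodule ≤ W ∧ q.submodule ≤ W ∧ r.submodule ≤ W)

/-- `W` determines a supporting line of `C` at the frontier point `p`: a projective line
containing `p` and disjoint from `C`. -/
def IsSupportingLineAt (C : Set (ℙ ℝ (Fin 3 → ℝ))) (W : Submodule ℝ (Fin 3 → ℝ))
    (p : ℙ ℝ (Fin 3 → ℝ)) : Prop :=
  finrank ℝ W = 2 ∧ p ∈ frontier C ∧ p.submodule ≤ W ∧ projLine W ∩ C = ∅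

/-- `(x, y, z)` is a positively oriented triple on the circle: `y` and `z` occur in that order
when traversing the circle counterclockwise starting from `x`.  (This implies the three points
are pairwise distinct.) -/
def PosOriented (x y z : Circle) : Prop :=
  ∃ a b c : ℝ, Circle.exp a = x ∧ Circle.exp b = y ∧ Circle.exp c = z ∧
    a < b ∧ b < c ∧ c < a + 2 * Real.pi

/-- The space of flags `(p, l)`, realized inside `ℙ(ℝ³) × ℙ((ℝ³)*)`: the pair `(p, φ)`
represents the flag whose line is the plane annihilated by `φ`, and `p` must lie on it. -/
def Flags : Set (ℙ ℝ (Fin 3 → ℝ) × ℙ ℝ (Module.Dual ℝ (Fin 3 → ℝ))) :=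
  {pl | pl.1.submodule ≤ pl.2.submodule.dualCoannihilator}

/-- The flags `(p, l)` with `p` outside the closure of `C` and `ℙ(l)` meeting `C`. -/
def Omega2 (C : Set (ℙ ℝ (Fin 3 → ℝ))) :
    Set (ℙ ℝ (Fin 3 → ℝ) × ℙ ℝ (Module.Dual ℝ (Fin 3 → ℝ))) :=
  {pl | pl ∈ Flags ∧ pl.1 ∉ closure C ∧
    ∃ q ∈ C, q.submodule ≤ pl.2.submodule.dualCoannihilator}


abbrev E3 := Fin 3 → ℝ

theorem continuous_mkP {V : Type*} [AddCommGroup V] [Module ℝ V] [TopologicalSpace V] :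
    Continuous (Projectivization.mk' ℝ : {v : V // v ≠ 0} → ℙ ℝ V) :=
  continuous_quotient_mk'

theorem isOpenMap_mkP : IsOpenMap (Projectivization.mk' ℝ : {v : E3 // v ≠ 0} → ℙ ℝ E3) := by
  intro U hU
  have h : IsOpen ((Projectivization.mk' ℝ : {v : E3 // v ≠ 0} → ℙ ℝ E3) ⁻¹'
      (Projectivization.mk' ℝ '' U)) := by
    have : ((Projectivization.mk' ℝ : {v : E3 // v ≠ 0} → ℙ ℝ E3) ⁻¹'
      (Projectivization.mk' ℝ '' U)) = ⋃ c : ℝˣ,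
        (fun v : {v : E3 // v ≠ 0} => (⟨c • v.1, (smul_ne_zero_iff_ne c).2 v.2⟩ :
          {v : E3 // v ≠ 0})) ⁻¹' U := by
      ext v
      simp only [Set.mem_preimage, Set.mem_image, Set.mem_iUnion]
      constructor
      · rintro ⟨w, hw, h⟩
        rw [Projectivization.mk'_eq_mk, Projectivization.mk'_eq_mk,
          Projectivization.mk_eq_mk_iff] at h
        obtain ⟨c, hc⟩ := h
        refine ⟨c, ?_⟩
        convert! hw
      · rintro ⟨c, hc⟩
        refine ⟨_, hc, ?_⟩
        rw [Projectivization.mk'_eq_mk, Projectivization.mk'_eq_mk,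
          Projectivization.mk_eq_mk_iff]
        exact ⟨c, rfl⟩
    rw [this]
    refine isOpen_iUnion fun c => hU.preimage ?_
    exact Continuous.subtype_mk (continuous_subtype_val.const_smul c) _
  exact h

def nrm (f : E3 →ₗ[ℝ] ℝ) (p : ℙ ℝ E3) : E3 := (f p.rep)⁻¹ • p.rep

theorem nrm_mk (f : E3 →ₗ[ℝ] ℝ) (v : E3) (hv : v ≠ 0) :
    nrm f (Projectivization.mk ℝ v hv) = (f v)⁻¹ • v := by
  obtain ⟨a, ha⟩ := Projectivization.exists_smul_eq_mk_rep ℝ v hv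
  have ha0 : (a : ℝ) ≠ 0 := a.ne_zero
  rw [nrm, ← ha, Units.smul_def, map_smul, smul_smul]
  congr 1
  rw [smul_eq_mul, mul_inv, mul_comm, ← mul_assoc, mul_inv_cancel₀ ha0, one_mul]

theorem nrm_tendsto (f : E3 →ₗ[ℝ] ℝ) (p : ℙ ℝ E3) (hp : f p.rep ≠ 0) :
    Tendsto (nrm f) (𝓝 p) (𝓝 (nrm f p)) := by
  have hm : (𝓝 p) = map (Projectivization.mk' ℝ) (𝓝 (⟨p.rep, p.rep_nonzero⟩ : {v : E3 // v ≠ 0})) := by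
    rw [isOpenMap_mkP.map_nhds_eq continuous_mkP.continuousAt]
    simp
  rw [hm, tendsto_map'_iff]
  have : (nrm f ∘ Projectivization.mk' ℝ) = fun v : {v : E3 // v ≠ 0} => (f v.1)⁻¹ • v.1 := by
    funext v
    exact nrm_mk f v.1 v.2
  rw [this]
  have hf : Continuous f := f.continuous_of_finiteDimensional
  have h1 : ContinuousAt (fun v : {v : E3 // v ≠ 0} => (f v.1)⁻¹ • v.1)
      ⟨p.rep, p.rep_nonzero⟩ := by
    have ha : ContinuousAt (fun v : {v : E3 // v ≠ 0} => f v.1) ⟨p.rep, p.rep_nonzero⟩ :=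
      (hf.comp continuous_subtype_val).continuousAt
    exact (ha.inv₀ hp).smul continuous_subtype_val.continuousAt
  exact h1

theorem nrm_ne (f : E3 →ₗ[ℝ] ℝ) (p : ℙ ℝ E3) (hp : f p.rep ≠ 0) : nrm f p ≠ 0 :=
  smul_ne_zero (inv_ne_zero hp) p.rep_nonzero

theorem mk_nrm (f : E3 →ₗ[ℝ] ℝ) (p : ℙ ℝ E3) (hp : f p.rep ≠ 0) :
    Projectivization.mk ℝ (nrm f p) (nrm_ne f p hp) = p := by
  conv_rhs => rw [← p.mk_rep]
  rw [Projectivization.mk_eq_mk_iff']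
  exact ⟨_, rfl⟩

theorem f_nrm (f : E3 →ₗ[ℝ] ℝ) (p : ℙ ℝ E3) (hp : f p.rep ≠ 0) : f (nrm f p) = 1 := by
  simp [nrm, hp]

theorem submodule_nrm (f : E3 →ₗ[ℝ] ℝ) (p : ℙ ℝ E3) (hp : f p.rep ≠ 0) :
    p.submodule = Submodule.span ℝ {nrm f p} := by
  conv_lhs => rw [← mk_nrm f p hp]
  rfl

/-- the open convex cone over `C` -/
def cone (f : E3 →ₗ[ℝ] ℝ) (C : Set (ℙ ℝ E3)) : Set E3 :=
  {w | 0 < f w ∧ ∃ hw : w ≠ 0, Projectivization.mk ℝ w hw ∈ C}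

theorem cone_open (f : E3 →ₗ[ℝ] ℝ) {C : Set (ℙ ℝ E3)} (hC : IsOpen C) : IsOpen (cone f C) := by
  have hf : Continuous f := f.continuous_of_finiteDimensional
  have h1 : IsOpen (Subtype.val '' ((Projectivization.mk' ℝ : {v : E3 // v ≠ 0} → ℙ ℝ E3) ⁻¹' C)) :=
    (isOpen_ne (x := (0 : E3))).isOpenMap_subtype_val _ (hC.preimage continuous_mkP)
  have h2 : cone f C = {w | 0 < f w} ∩
      (Subtype.val '' ((Projectivization.mk' ℝ : {v : E3 // v ≠ 0} → ℙ ℝ E3) ⁻¹' C)) := by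
    ext w
    constructor
    · rintro ⟨h, hw, hm⟩
      exact ⟨h, ⟨w, hw⟩, hm, rfl⟩
    · rintro ⟨h, ⟨w', hw⟩, hm, rfl⟩
      exact ⟨h, hw, hm⟩
  rw [h2]
  exact (isOpen_lt continuous_const hf).inter h1

theorem cone_smul (f : E3 →ₗ[ℝ] ℝ) {C : Set (ℙ ℝ E3)} {w : E3} (hw : w ∈ cone f C) {c : ℝ}
    (hc : 0 < c) : c • w ∈ cone f C := by
  obtain ⟨h, h0, hm⟩ := hw
  refine ⟨by rw [map_smul]; exact mul_pos hc h, smul_ne_zero hc.ne' h0, ?_⟩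
  convert hm using 1
  rw [Projectivization.mk_eq_mk_iff']
  exact ⟨c, rfl⟩

theorem cone_convex (f : E3 →ₗ[ℝ] ℝ) {C : Set (ℙ ℝ E3)}
    (h : Convex ℝ {w : E3 | f w = 1 ∧ ∃ hw : w ≠ 0, Projectivization.mk ℝ w hw ∈ C}) :
    Convex ℝ (cone f C) := by
  rw [convex_iff_forall_pos]
  intro x hx y hy a b ha hb hab
  have hfx := hx.1
  have hfy := hy.1
  have hx' := cone_smul f hx (inv_pos.2 hfx)
  have hy' := cone_smul f hy (inv_pos.2 hfy)
  have hs : 0 < a * f x + b * f y := by positivity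
  have key := h (x := (f x)⁻¹ • x) ⟨by simp [hfx.ne'], hx'.2⟩ (y := (f y)⁻¹ • y)
    ⟨by simp [hfy.ne'], hy'.2⟩
    (a := a * f x / (a * f x + b * f y)) (b := b * f y / (a * f x + b * f y))
    (by positivity) (by positivity) (by field_simp)
  have k2 := cone_smul f (C := C) (w := _) ⟨by rw [key.1]; exact one_pos, key.2⟩ hs
  convert k2 using 1
  rw [smul_add, smul_smul, smul_smul, smul_smul, smul_smul]
  congr 2 <;> field_simp

theorem cone_closure (f : E3 →ₗ[ℝ] ℝ) {C : Set (ℙ ℝ E3)} {w : E3} (h0 : w ≠ 0) (hw : 0 < f w)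
    (hm : Projectivization.mk ℝ w h0 ∈ closure C) : w ∈ closure (cone f C) := by
  have hf : Continuous f := f.continuous_of_finiteDimensional
  rw [mem_closure_iff] at hm ⊢
  intro U hU hwU
  have hU' : IsOpen (U ∩ {w | 0 < f w}) := hU.inter (isOpen_lt continuous_const hf)
  obtain ⟨p, ⟨v, hv, rfl⟩, hp⟩ := hm _ (isOpenMap_mkP _ (hU'.preimage continuous_subtype_val))
    ⟨⟨w, h0⟩, ⟨hwU, hw⟩, rfl⟩
  exact ⟨v.1, hv.1, hv.2, v.2, hp⟩

abbrev DD : E3 ≃ₗ[ℝ] Module.Dual ℝ E3 := (LinearEquiv.piRing ℝ ℝ (Fin 3) ℝ).symm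

theorem DD_tendsto {x : ℕ → E3} {w : ℕ → E3} {x0 w0 : E3} (hx : Tendsto x atTop (𝓝 x0))
    (hw : Tendsto w atTop (𝓝 w0)) : Tendsto (fun n => DD (x n) (w n)) atTop (𝓝 (DD x0 w0)) := by
  simp only [DD, LinearEquiv.piRing_symm_apply, smul_eq_mul]
  refine tendsto_finsetSum _ fun i _ => Tendsto.mul ?_ ?_
  · exact (tendsto_pi_nhds.1 hw) i
  · exact (tendsto_pi_nhds.1 hx) i

theorem DD_continuous : Continuous (DD : E3 → Module.Dual ℝ E3) := by
  rw [continuous_induced_rng]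
  convert continuous_id using 1
  funext x
  simp [DD]

theorem core (f : E3 →ₗ[ℝ] ℝ) (K : Set E3) (hKo : IsOpen K) (hKc : Convex ℝ K)
    (u v x : ℕ → E3) (u0 x0 w : E3)
    (hu : ∀ n, u n ∈ closure K) (hu' : ∀ n, u n ∉ K)
    (hv : ∀ n, v n ∈ closure K) (hv' : ∀ n, v n ∉ K) (hu0 : u0 ∉ K)
    (hfu : ∀ n, f (u n) = 1) (hfv : ∀ n, f (v n) = 1) (hfu0 : f u0 = 1)
    (hlu : Tendsto u atTop (𝓝 u0)) (hlv : Tendsto v atTop (𝓝 u0)) (hlx : Tendsto x atTop (𝓝 x0))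
    (hspan : ∀ n e, DD (x n) e = 0 → e ∈ Submodule.span ℝ {u n, v n})
    (hx0 : x0 ≠ 0) (hxu : DD x0 u0 = 0) (hwK : w ∈ K) (hfw : f w = 1) (hxw : DD x0 w = 0) :
    False := by
  obtain ⟨e0, he0⟩ : ∃ e0, DD x0 e0 ≠ 0 := by
    by_contra! h
    exact hx0 (DD.map_eq_zero_iff.1 (LinearMap.ext h))
  set e := e0 - f e0 • u0 with he
  have hfe : f e = 0 := by simp [he, hfu0]
  have hxe : DD x0 e ≠ 0 := by rw [he, map_sub, map_smul, hxu]; simpa using he0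
  have hle := DD_tendsto hlx (tendsto_const_nhds (x := e))
  have hlw := DD_tendsto hlx (tendsto_const_nhds (x := w))
  set W : ℕ → E3 := fun n => w - (DD (x n) w / DD (x n) e) • e with hW
  have hWl : Tendsto W atTop (𝓝 w) := by
    have := (tendsto_const_nhds (x := w)).sub ((hlw.div hle hxe).smul (tendsto_const_nhds (x := e)))
    rw [hxw, zero_div, zero_smul, sub_zero] at this
    exact this
  have hev : ∀ᶠ n in atTop, ‖W n - u n‖ ≤ ‖v n - u n‖ := by
    filter_upwards [hle.eventually_ne hxe, hWl.eventually_mem (hKo.mem_nhds hwK)] with n h1 h2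
    have h3 : DD (x n) (W n) = 0 := by
      rw [hW]
      simp only [map_sub, map_smul, smul_eq_mul]
      field_simp
      simp
    have hfW : f (W n) = 1 := by simp [hW, hfe, hfw]
    obtain ⟨s, t, hst⟩ := Submodule.mem_span_pair.1 (hspan n _ h3)
    have hsum : s + t = 1 := by
      rw [← hst] at hfW
      simpa [hfu, hfv] using hfW
    have hs : s = 1 - t := by linarith
    subst hs
    have hint : W n ∈ interior K := by rwa [hKo.interior_eq]
    rcases lt_or_ge t 0 with ht | ht
    · exfalso
      have hpos : 0 < 1 - t := by linarith
      have := hKc.combo_interior_closure_mem_interior hint (hv n) (a := (1-t)⁻¹)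
        (b := -t * (1-t)⁻¹) (by positivity) (mul_nonneg (by linarith) (by positivity))
        (by field_simp; ring)
      rw [hKo.interior_eq] at this
      apply hu' n
      convert this using 1
      rw [← hst, smul_add, smul_smul, smul_smul, inv_mul_cancel₀ hpos.ne', one_smul, add_assoc,
        ← add_smul]
      rw [show (1 - t)⁻¹ * t + -t * (1 - t)⁻¹ = 0 by ring]
      simp
    rcases lt_or_ge 1 t with ht1 | ht1
    · exfalso
      have hpos : 0 < t := by linarith
      have := hKc.combo_interior_closure_mem_interior hint (hu n) (a := t⁻¹)
        (b := (t - 1) * t⁻¹) (by positivity) (mul_nonneg (by linarith) (by positivity))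
        (by field_simp; ring)
      rw [hKo.interior_eq] at this
      apply hv' n
      convert this using 1
      rw [← hst, smul_add, smul_smul, smul_smul, inv_mul_cancel₀ hpos.ne', one_smul, add_right_comm,
        ← add_smul]
      rw [show t⁻¹ * (1 - t) + (t - 1) * t⁻¹ = 0 by ring]
      simp
    · have : W n - u n = t • (v n - u n) := by
        rw [← hst]; module
      rw [this, norm_smul, Real.norm_of_nonneg ht]
      exact mul_le_of_le_one_left (norm_nonneg _) ht1
  have hlim := le_of_tendsto_of_tendsto (hWl.sub hlu).norm (hlv.sub hlu).norm hev
  rw [sub_self, norm_zero] at hlim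
  have : w = u0 := sub_eq_zero.1 (norm_le_zero_iff.1 hlim)
  exact hu0 (this ▸ hwK)

theorem exists_unit (p : ℙ ℝ (Module.Dual ℝ E3)) :
    ∃ x : E3, ‖x‖ = 1 ∧ ∃ h : DD x ≠ 0, Projectivization.mk ℝ (DD x) h = p := by
  have hx : DD.symm p.rep ≠ 0 := by
    simpa using p.rep_nonzero
  have hn : ‖DD.symm p.rep‖ ≠ 0 := norm_ne_zero_iff.2 hx
  have hD : DD (‖DD.symm p.rep‖⁻¹ • DD.symm p.rep) = ‖DD.symm p.rep‖⁻¹ • p.rep := by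
    rw [map_smul, LinearEquiv.apply_symm_apply]
  refine ⟨‖DD.symm p.rep‖⁻¹ • DD.symm p.rep, ?_, ?_, ?_⟩
  · rw [norm_smul, norm_inv, norm_norm, inv_mul_cancel₀ hn]
  · rw [hD]; exact smul_ne_zero (inv_ne_zero hn) p.rep_nonzero
  · conv_rhs => rw [← p.mk_rep]
    rw [Projectivization.mk_eq_mk_iff']
    exact ⟨_, hD.symm⟩

theorem finrank_ann {W : Submodule ℝ E3} (h : finrank ℝ W = 2) :
    finrank ℝ W.dualAnnihilator = 1 := by
  have := Subspace.finrank_add_finrank_dualAnnihilator_eq W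
  rw [h, Module.finrank_fin_fun] at this
  omega

theorem finrank_sup {p q : ℙ ℝ E3} (h : p ≠ q) :
    finrank ℝ (p.submodule ⊔ q.submodule : Submodule ℝ E3) = 2 := by
  have h1 := Submodule.finrank_sup_add_finrank_inf_eq p.submodule q.submodule
  rw [p.finrank_submodule, q.finrank_submodule] at h1
  have h2 : finrank ℝ (p.submodule ⊓ q.submodule : Submodule ℝ E3) = 0 := by
    by_contra hne
    have hp : p.submodule ⊓ q.submodule = p.submodule :=
      Submodule.eq_of_le_of_finrank_le inf_le_left (by rw [p.finrank_submodule]; omega)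
    have hq : p.submodule ⊓ q.submodule = q.submodule :=
      Submodule.eq_of_le_of_finrank_le inf_le_right (by rw [q.finrank_submodule]; omega)
    exact h (Projectivization.submodule_injective (hp.symm.trans hq))
  omega

theorem mem_coann {p : ℙ ℝ (Module.Dual ℝ E3)} {W : Submodule ℝ E3} {x : E3} (h : DD x ≠ 0)
    (hp : Projectivization.mk ℝ (DD x) h = p) (hW : p.submodule = W.dualAnnihilator) (e : E3) :
    e ∈ W ↔ DD x e = 0 := by
  have h1 : W = p.submodule.dualCoannihilator := by
    rw [hW, Subspace.dualAnnihilator_dualCoannihilator_eq]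
  rw [h1, ← hp, Projectivization.submodule_mk, Submodule.mem_dualCoannihilator]
  constructor
  · intro hh
    exact hh _ (Submodule.mem_span_singleton_self _)
  · intro hh φ hφ
    obtain ⟨c, rfl⟩ := Submodule.mem_span_singleton.1 hφ
    simp [hh]

/-- If `(y_n)` and `(z_n)` are sequences on the circle with `y_n ≠ z_n`, both
converging to `a`, then the planes `y_n¹ + z_n¹` converge to `ξ²(a)`, in the sense that the
corresponding points of `ℙ((ℝ³)*)` given by their annihilators converge to the point given by
the annihilator of `ξ²(a)`. -/
theorem statement_6
    (C : Set (ℙ ℝ (Fin 3 → ℝ))) (hCopen : IsOpen C) (hCpc : ProperlyConvex C)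
    (hstrict : StrictlyConvexBoundary C)
    (hC1 : ∀ p ∈ frontier C, ∃! W : Submodule ℝ (Fin 3 → ℝ), IsSupportingLineAt C W p)
    (ξ₁ : Circle → ℙ ℝ (Fin 3 → ℝ))
    (hξ₁ : ∃ e : Circle ≃ₜ frontier C, ∀ x, (e x : ℙ ℝ (Fin 3 → ℝ)) = ξ₁ x)
    (ξ₂ : Circle → Submodule ℝ (Fin 3 → ℝ))
    (hξ₂ : ∀ x, IsSupportingLineAt C (ξ₂ x) (ξ₁ x))
    (y z : ℕ → Circle) (hyz : ∀ n, y n ≠ z n) (a : Circle)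
    (hy : Tendsto y atTop (𝓝 a)) (hz : Tendsto z atTop (𝓝 a)) :
    ∃ q : ℕ → ℙ ℝ (Module.Dual ℝ (Fin 3 → ℝ)), ∃ Q : ℙ ℝ (Module.Dual ℝ (Fin 3 → ℝ)),
      (∀ n, (q n).submodule =
        ((ξ₁ (y n)).submodule ⊔ (ξ₁ (z n)).submodule).dualAnnihilator) ∧
      Q.submodule = (ξ₂ a).dualAnnihilator ∧
      Tendsto q atTop (𝓝 Q) := by
  obtain ⟨f, hf1, hf2⟩ := hCpc
  obtain ⟨e, he⟩ := hξ₁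
  have hfr : ∀ t, ξ₁ t ∈ frontier C := fun t => he t ▸ (e t).2
  have hrep : ∀ p ∈ closure C, f p.rep ≠ 0 := fun p hp =>
    hf1 _ p.rep_nonzero (by rwa [Projectivization.mk_rep])
  have hξf : ∀ t, f (ξ₁ t).rep ≠ 0 := fun t => hrep _ (frontier_subset_closure (hfr t))
  have hinj : Function.Injective ξ₁ := fun s t h => by
    apply e.injective
    apply Subtype.ext
    rw [he, he, h]
  have hcont : Continuous ξ₁ := by
    have : ξ₁ = fun t => (e t : ℙ ℝ (Fin 3 → ℝ)) := funext fun t => (he t).symm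
    rw [this]
    exact continuous_subtype_val.comp e.continuous
  have hnl : ∀ s : ℕ → Circle, Tendsto s atTop (𝓝 a) →
      Tendsto (fun n => nrm f (ξ₁ (s n))) atTop (𝓝 (nrm f (ξ₁ a))) := fun s hs =>
    (nrm_tendsto f _ (hξf a)).comp ((hcont.tendsto a).comp hs)
  have hncl : ∀ t, nrm f (ξ₁ t) ∈ closure (cone f C) := fun t => by
    refine cone_closure f (nrm_ne f _ (hξf t)) (by rw [f_nrm f _ (hξf t)]; exact one_pos) ?_
    rw [mk_nrm f _ (hξf t)]
    exact frontier_subset_closure (hfr t)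
  have hnn : ∀ t, nrm f (ξ₁ t) ∉ cone f C := fun t ht => by
    obtain ⟨-, h0, hm⟩ := ht
    rw [mk_nrm f _ (hξf t)] at hm
    have := hfr t
    rw [hCopen.frontier_eq] at this
    exact this.2 hm
  have hne : ∀ n, ξ₁ (y n) ≠ ξ₁ (z n) := fun n h => hyz n (hinj h)
  let q : ℕ → ℙ ℝ (Module.Dual ℝ (Fin 3 → ℝ)) := fun n =>
    Projectivization.mk'' _ (finrank_ann (finrank_sup (hne n)))
  have hq : ∀ n, (q n).submodule =
        ((ξ₁ (y n)).submodule ⊔ (ξ₁ (z n)).submodule).dualAnnihilator := fun n =>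
    Projectivization.submodule_mk'' _ _
  let Q : ℙ ℝ (Module.Dual ℝ (Fin 3 → ℝ)) := Projectivization.mk'' _ (finrank_ann (hξ₂ a).1)
  have hQ : Q.submodule = (ξ₂ a).dualAnnihilator := Projectivization.submodule_mk'' _ _
  refine ⟨q, Q, hq, hQ, ?_⟩
  choose x hx1 hx0 hxq using fun n => exists_unit (q n)
  apply tendsto_of_subseq_tendsto
  intro ns hns
  obtain ⟨x0, hx0S, ms, hms, hlim⟩ := (isCompact_sphere (0 : E3) 1).tendsto_subseq
    (x := fun n => x (ns n)) (fun n => by simpa using hx1 (ns n))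
  refine ⟨ms, ?_⟩
  have hx00 : x0 ≠ 0 := by
    rintro rfl
    simp at hx0S
  have hD0 : DD x0 ≠ 0 := fun h => hx00 (DD.map_eq_zero_iff.1 h)
  have hsub : Tendsto (fun n => ns (ms n)) atTop atTop := hns.comp hms.tendsto_atTop
  have hyl := hnl _ (hy.comp hsub)
  have hzl := hnl _ (hz.comp hsub)
  have hxu : DD x0 (nrm f (ξ₁ a)) = 0 := by
    have h1 := DD_tendsto hlim hyl
    refine tendsto_nhds_unique h1 ?_
    convert tendsto_const_nhds using 1
    funext n
    refine ((mem_coann (hx0 _) (hxq _) (hq _)) _).1 ?_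
    apply Submodule.mem_sup_left
    rw [submodule_nrm f _ (hξf _)]
    exact Submodule.mem_span_singleton_self _
  have hQ0 : Projectivization.mk ℝ (DD x0) hD0 = Q := by
    apply Projectivization.submodule_injective
    have hfin : finrank ℝ (Projectivization.mk ℝ (DD x0) hD0).submodule.dualCoannihilator = 2 := by
      have := Subspace.finrank_add_finrank_dualCoannihilator_eq
        (Projectivization.mk ℝ (DD x0) hD0).submodule
      rw [Projectivization.finrank_submodule, Module.finrank_fin_fun] at this
      omega
    have hann : (Projectivization.mk ℝ (DD x0) hD0).submodule =
        (Projectivization.mk ℝ (DD x0) hD0).submodule.dualCoannihilator.dualAnnihilator :=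
      Subspace.dualCoannihilator_dualAnnihilator_eq.symm
    have hmem := mem_coann hD0 rfl hann
    have hsupp : IsSupportingLineAt C
        (Projectivization.mk ℝ (DD x0) hD0).submodule.dualCoannihilator (ξ₁ a) := by
      refine ⟨hfin, hfr a, ?_, ?_⟩
      · rw [submodule_nrm f _ (hξf a), Submodule.span_singleton_le_iff_mem]
        exact (hmem _).2 hxu
      · rw [Set.eq_empty_iff_forall_notMem]
        rintro p ⟨hpl, hpC⟩
        have hpf := hrep p (subset_closure hpC)
        have hpm : nrm f p ∈ p.submodule := by
          rw [submodule_nrm f p hpf]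
          exact Submodule.mem_span_singleton_self _
        refine core f (cone f C) (cone_open f hCopen) (cone_convex f hf2)
          _ _ _ (nrm f (ξ₁ a)) x0 (nrm f p) (fun n => hncl _) (fun n => hnn _) (fun n => hncl _)
          (fun n => hnn _) (hnn a) (fun n => f_nrm f _ (hξf _)) (fun n => f_nrm f _ (hξf _))
          (f_nrm f _ (hξf a)) hyl hzl hlim ?_ hx00 hxu ?_ (f_nrm f p hpf) ((hmem _).1 (hpl hpm))
        · intro n e' he'
          have := ((mem_coann (hx0 _) (hxq _) (hq _)) _).2 he'
          rw [submodule_nrm f _ (hξf _), submodule_nrm f _ (hξf _)] at this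
          rw [Submodule.span_insert]
          exact this
        · refine ⟨by rw [f_nrm f p hpf]; exact one_pos, nrm_ne f p hpf, ?_⟩
          rwa [mk_nrm f p hpf]
    rw [hQ, hann, (hC1 _ (hfr a)).unique hsupp (hξ₂ a)]
  rw [← hQ0]
  have h1 : Tendsto (fun n => (⟨DD (x (ns (ms n))), hx0 _⟩ : {v : Module.Dual ℝ E3 // v ≠ 0})) atTop
      (𝓝 ⟨DD x0, hD0⟩) := by
    rw [tendsto_subtype_rng]
    exact (DD_continuous.tendsto x0).comp hlim
  have h2 := (continuous_mkP.tendsto _).comp h1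
  convert! h2 using 1
  funext n
  exact (hxq _).symm

end CFF
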